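/- arXiv:2211.01595 — 3 statements merged into one kernel-verified Lean document; each statement's English description precedes it below -/
import Mathlib

section
/- The averaged map Ḡ defined by Ḡ(Q)(s,u) := π̃(s,u)·(T Q)(s,u) + (1 − π̃(s,u))·Q(s,u) satisfies ‖Ḡ(Q) − Ḡ(Q')‖_∞ ≤ α·‖Q − Q'‖_∞ for all Q, Q' ∈ ℝ^{𝒮×𝒰} with α := 1 − (1−γ)·π_min ∈ (0,1); moreover Ḡ(Q) = Q if and only if T(Q) = Q, so the unique fixed point of Ḡ is the unique fixed point Q* of T. -/
open Finset

/-- Finite suprema of real functions are nonexpansive in the uniform distance. -/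
theorem abs_ciSup_sub_ciSup_le {ι : Type*} [Finite ι] [Nonempty ι] {f g : ι → ℝ} {c : ℝ}
    (h : ∀ i, |f i - g i| ≤ c) : |(⨆ i, f i) - ⨆ i, g i| ≤ c := by
  have key : ∀ {u v : ι → ℝ}, (∀ i, u i ≤ v i + c) → (⨆ i, u i) ≤ (⨆ i, v i) + c :=
    fun {u v} huv => ciSup_le fun i =>
      (huv i).trans (by gcongr; exact le_ciSup (Set.finite_range v).bddAbove i)
  rw [abs_sub_le_iff]
  constructor
  · linarith [key fun i => show f i ≤ g i + c by linarith [(abs_sub_le_iff.1 (h i)).1]]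
  · linarith [key fun i => show g i ≤ f i + c by linarith [(abs_sub_le_iff.1 (h i)).2]]

/-- A weighted average with nonnegative weights of total mass one preserves absolute bounds. -/
theorem abs_sum_mul_sub_sum_mul_le {ι : Type*} [Fintype ι] {w f g : ι → ℝ} {c : ℝ}
    (hw0 : ∀ i, 0 ≤ w i) (hw1 : ∑ i, w i = 1) (h : ∀ i, |f i - g i| ≤ c) :
    |∑ i, w i * f i - ∑ i, w i * g i| ≤ c :=
  calc |∑ i, w i * f i - ∑ i, w i * g i| = |∑ i, w i * (f i - g i)| := by
        simp only [mul_sub, Finset.sum_sub_distrib]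
    _ ≤ ∑ i, |w i * (f i - g i)| := Finset.abs_sum_le_sum_abs _ _
    _ ≤ ∑ i, w i * c := Finset.sum_le_sum fun i _ => by
        rw [abs_mul, abs_of_nonneg (hw0 i)]
        exact mul_le_mul_of_nonneg_left (h i) (hw0 i)
    _ = c := by rw [← Finset.sum_mul, hw1, one_mul]

/-- The averaged map `Ḡ(Q)(s,u) = π̃(s,u)·(T Q)(s,u) + (1 − π̃(s,u))·Q(s,u)`
is an `α`-contraction in the sup norm with `α = 1 − (1−γ)·π_min ∈ (0,1)`, and its fixed
points are exactly the fixed points of the Bellman operator `T`; in particular `Ḡ` has the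
unique fixed point `Q*` of `T`. -/
theorem averaged_bellman_contraction
    (𝒮 𝒰 : Type) [Fintype 𝒮] [Fintype 𝒰] [Nonempty 𝒮] [Nonempty 𝒰]
    (γ : ℝ) (hγ : γ ∈ Set.Ioo (0 : ℝ) 1)
    (rbar : 𝒮 × 𝒰 → ℝ) (hr : ∀ z, rbar z ∈ Set.Icc (0 : ℝ) 1)
    (q : 𝒮 × 𝒰 → 𝒮 → ℝ) (hq0 : ∀ z s', 0 ≤ q z s') (hq1 : ∀ z, ∑ s', q z s' = 1)
    (T : (𝒮 × 𝒰 → ℝ) → (𝒮 × 𝒰 → ℝ))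
    (hT : ∀ Q s u, T Q (s, u) = rbar (s, u) + γ * ∑ s', q (s, u) s' * (⨆ a, Q (s', a)))
    (πt : 𝒮 × 𝒰 → ℝ) (hπ0 : ∀ z, 0 < πt z) (hπ1 : ∑ z, πt z = 1)
    (πmin : ℝ) (hπmin : πmin = ⨅ z, πt z)
    (α : ℝ) (hα : α = 1 - (1 - γ) * πmin)
    (G : (𝒮 × 𝒰 → ℝ) → (𝒮 × 𝒰 → ℝ))
    (hG : ∀ Q z, G Q z = πt z * T Q z + (1 - πt z) * Q z) :
    (0 < α ∧ α < 1) ∧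
    (∀ Q Q' : 𝒮 × 𝒰 → ℝ, ‖G Q - G Q'‖ ≤ α * ‖Q - Q'‖) ∧
    (∀ Q : 𝒮 × 𝒰 → ℝ, G Q = Q ↔ T Q = Q) ∧
    (∃! Qstar : 𝒮 × 𝒰 → ℝ, G Qstar = Qstar) ∧
    (∀ Qstar : 𝒮 × 𝒰 → ℝ, T Qstar = Qstar → (∀ Q : 𝒮 × 𝒰 → ℝ, G Q = Q → Q = Qstar)) := by
  obtain ⟨hγ0, hγ1⟩ := hγ
  have hmin_le : ∀ z, πmin ≤ πt z := fun z =>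
    hπmin ▸ ciInf_le (Set.finite_range πt).bddBelow z
  have hle_one : ∀ z, πt z ≤ 1 := fun z =>
    hπ1 ▸ Finset.single_le_sum (fun i _ => (hπ0 i).le) (Finset.mem_univ z)
  obtain ⟨z₀, hz₀⟩ := exists_eq_ciInf_of_finite (f := πt)
  have hmin_pos : 0 < πmin := by rw [hπmin, ← hz₀]; exact hπ0 z₀
  have hmin_one : πmin ≤ 1 := (hmin_le z₀).trans (hle_one z₀)
  have hα0 : 0 < α := by rw [hα]; nlinarith
  have hα1 : α < 1 := by rw [hα]; nlinarith
  have hTcontr : ∀ Q Q' z, |T Q z - T Q' z| ≤ γ * ‖Q - Q'‖ := by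
    rintro Q Q' ⟨s, u⟩
    rw [hT, hT, add_sub_add_left_eq_sub, ← mul_sub, abs_mul, abs_of_pos hγ0]
    refine mul_le_mul_of_nonneg_left ?_ hγ0.le
    exact abs_sum_mul_sub_sum_mul_le (hq0 _) (hq1 _) fun s' =>
      abs_ciSup_sub_ciSup_le fun a => norm_le_pi_norm (Q - Q') (s', a)
  have hGcontr : ∀ Q Q' : 𝒮 × 𝒰 → ℝ, ‖G Q - G Q'‖ ≤ α * ‖Q - Q'‖ := by
    intro Q Q'
    refine (pi_norm_le_iff_of_nonneg (by positivity)).2 fun z => ?_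
    have hQ : |Q z - Q' z| ≤ ‖Q - Q'‖ := norm_le_pi_norm (Q - Q') z
    calc ‖(G Q - G Q') z‖
        = |πt z * (T Q z - T Q' z) + (1 - πt z) * (Q z - Q' z)| := by
          rw [Pi.sub_apply, hG, hG, Real.norm_eq_abs]; ring_nf
      _ ≤ πt z * |T Q z - T Q' z| + (1 - πt z) * |Q z - Q' z| := by
          refine (abs_add_le _ _).trans_eq ?_
          rw [abs_mul, abs_mul, abs_of_pos (hπ0 z), abs_of_nonneg (sub_nonneg.2 (hle_one z))]
      _ ≤ πt z * (γ * ‖Q - Q'‖) + (1 - πt z) * ‖Q - Q'‖ :=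
          add_le_add (mul_le_mul_of_nonneg_left (hTcontr Q Q' z) (hπ0 z).le)
            (mul_le_mul_of_nonneg_left hQ (sub_nonneg.2 (hle_one z)))
      _ = (1 - (1 - γ) * πt z) * ‖Q - Q'‖ := by ring
      _ ≤ α * ‖Q - Q'‖ := by
          refine mul_le_mul_of_nonneg_right ?_ (norm_nonneg _)
          rw [hα]
          exact sub_le_sub_left
            (mul_le_mul_of_nonneg_left (hmin_le z) (sub_nonneg.2 hγ1.le)) 1
  have hfix : ∀ Q : 𝒮 × 𝒰 → ℝ, G Q = Q ↔ T Q = Q := by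
    intro Q
    simp only [funext_iff, hG]
    refine forall_congr' fun z => ⟨fun h => ?_, fun h => by rw [h]; ring⟩
    exact mul_left_cancel₀ (hπ0 z).ne' (by linarith)
  have hG_contracting : ContractingWith ⟨α, hα0.le⟩ G :=
    ⟨hα1, LipschitzWith.of_dist_le_mul fun Q Q' => by
      rw [dist_eq_norm, dist_eq_norm]; exact hGcontr Q Q'⟩
  refine ⟨⟨hα0, hα1⟩, hGcontr, hfix, ?_, fun Qstar hQstar Q hQ => ?_⟩
  · exact ⟨ContractingWith.fixedPoint G hG_contracting, hG_contracting.fixedPoint_isFixedPt,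
      fun Q hQ => hG_contracting.fixedPoint_unique hQ⟩
  · exact hG_contracting.fixedPoint_unique' hQ ((hfix Qstar).2 hQstar)
end

section
/- If the stepsizes additionally satisfy a(n) ∈ [0,1] for all n, then the Q-learning iterates remain bounded: Q_n(s,u) ∈ [0, 1/(1−γ)] for all n ≥ 0 and all (s,u) ∈ 𝒮×𝒰 (surely, i.e., for every realization of the processes). -/
open Finset

/-- The one-step target `ρ + γ max q` lies in `[0, 1/(1-γ)]` when `ρ ∈ [0,1]` and `q` takes values
in `[0, 1/(1-γ)]`. -/
lemma bellman_target_mem_Icc {ι : Type*} [Nonempty ι] {γ ρ : ℝ} (hγ0 : 0 ≤ γ) (hγ1 : γ < 1)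
    (hρ : ρ ∈ Set.Icc (0 : ℝ) 1) {q : ι → ℝ} (hq : ∀ i, q i ∈ Set.Icc (0 : ℝ) (1 / (1 - γ))) :
    ρ + γ * (⨆ i, q i) ∈ Set.Icc (0 : ℝ) (1 / (1 - γ)) := by
  have hsup_nonneg : 0 ≤ ⨆ i, q i := Real.iSup_nonneg fun i => (hq i).1
  have hsup_le : ⨆ i, q i ≤ 1 / (1 - γ) := ciSup_le fun i => (hq i).2
  have hfix : 1 + γ * (1 / (1 - γ)) = 1 / (1 - γ) := by
    have : 1 - γ ≠ 0 := by linarith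
    field_simp
    ring
  refine ⟨add_nonneg hρ.1 (mul_nonneg hγ0 hsup_nonneg), ?_⟩
  rw [← hfix]
  exact add_le_add hρ.2 (mul_le_mul_of_nonneg_left hsup_le hγ0)

/-- If the stepsizes satisfy `a(n) ∈ [0,1]`, then the Q-learning iterates,
initialized in `[0, 1/(1-γ)]`, remain in `[0, 1/(1-γ)]` for every realization. -/
theorem q_learning_iterates_bounded
    (𝒮 𝒰 𝒪 Ω : Type) [Fintype 𝒮] [Fintype 𝒰] [Fintype 𝒪]
    [Nonempty 𝒮] [Nonempty 𝒰] [Nonempty 𝒪]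
    [DecidableEq 𝒮] [DecidableEq 𝒰]
    (S : ℕ → Ω → 𝒮) (U : ℕ → Ω → 𝒰) (O : ℕ → Ω → 𝒪)
    (r : 𝒮 → 𝒰 → 𝒪 → ℝ) (hr : ∀ s u o, r s u o ∈ Set.Icc (0 : ℝ) 1)
    (γ : ℝ) (hγ : γ ∈ Set.Ioo (0 : ℝ) 1)
    (a : ℕ → ℝ) (ha : ∀ n, a n ∈ Set.Icc (0 : ℝ) 1)
    (Q : ℕ → Ω → 𝒮 × 𝒰 → ℝ)
    (hQ0 : ∀ ω z, Q 0 ω z ∈ Set.Icc (0 : ℝ) (1 / (1 - γ)))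
    (hrec : ∀ n ω s u,
      Q (n + 1) ω (s, u) = Q n ω (s, u) +
        a n * (if S n ω = s ∧ U n ω = u then (1 : ℝ) else 0) *
          (r (S n ω) (U n ω) (O (n + 1) ω) + γ * (⨆ a', Q n ω (S (n + 1) ω, a'))
            - Q n ω (s, u))) :
    ∀ n ω z, Q n ω z ∈ Set.Icc (0 : ℝ) (1 / (1 - γ)) := by
  obtain ⟨hγ0, hγ1⟩ := hγ
  intro n ω
  induction n with
  | zero => exact hQ0 ω
  | succ n ih =>
    rintro ⟨s, u⟩
    rw [hrec]
    split_ifs with h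
    · rw [mul_one]
      refine (convex_Icc (0 : ℝ) (1 / (1 - γ))).add_smul_sub_mem (ih (s, u)) ?_ (ha n)
      exact bellman_target_mem_Icc hγ0.le hγ1 (hr (S n ω) (U n ω) (O (n + 1) ω))
        fun a' => ih (S (n + 1) ω, a')
    · simpa using ih (s, u)
end

section
/- Any differentiable solution q : [0,∞) → ℝ^d of the ordinary differential equation q_i'(t) = π_i·((T q(t))_i − q_i(t)) for all i and t ≥ 0 converges to x* as t → ∞; in fact ‖q(t) − x*‖_∞ ≤ e^{−(1−γ)·π_min·t}·‖q(0) − x*‖_∞ for all t ≥ 0, where π_min := min_i π_i. -/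
open Filter

/-- One explicit Euler step, of size at most `1 / p i` in every coordinate, for the field
`p i * (u i - e i)` shrinks the sup norm of `e` when `‖u‖ ≤ γ * ‖e‖`. -/
theorem norm_eulerStep_le {ι : Type*} [Fintype ι] {γ m h : ℝ} (hγ : γ ≤ 1)
    {p e u : ι → ℝ} (hm : ∀ i, m ≤ p i) (hm0 : 0 ≤ m) (hu : ‖u‖ ≤ γ * ‖e‖)
    (hh : 0 ≤ h) (hp : ∀ i, h * p i ≤ 1) :
    ‖e + h • (fun i => p i * (u i - e i))‖ ≤ ‖e‖ - h * ((1 - γ) * m * ‖e‖) := by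
  have key : ∀ i, |e i + h * (p i * (u i - e i))| ≤ ‖e‖ - h * ((1 - γ) * m * ‖e‖) := by
    intro i
    have hpi : 0 ≤ h * p i := mul_nonneg hh (hm0.trans (hm i))
    have he : |e i| ≤ ‖e‖ := norm_le_pi_norm e i
    have hui : |u i| ≤ γ * ‖e‖ := (norm_le_pi_norm u i).trans hu
    calc |e i + h * (p i * (u i - e i))|
        = |(1 - h * p i) * e i + h * p i * u i| := by ring_nf
      _ ≤ |(1 - h * p i) * e i| + |h * p i * u i| := abs_add_le _ _
      _ = (1 - h * p i) * |e i| + h * p i * |u i| := by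
        rw [abs_mul, abs_mul, abs_of_nonneg (sub_nonneg.2 (hp i)), abs_of_nonneg hpi]
      _ ≤ (1 - h * p i) * ‖e‖ + h * p i * (γ * ‖e‖) :=
        add_le_add (mul_le_mul_of_nonneg_left he (sub_nonneg.2 (hp i)))
          (mul_le_mul_of_nonneg_left hui hpi)
      _ = ‖e‖ - h * ((1 - γ) * p i * ‖e‖) := by ring
      _ ≤ ‖e‖ - h * ((1 - γ) * m * ‖e‖) := by
        have := sub_nonneg.2 hγ
        gcongr
        exact hm i
  rcases isEmpty_or_nonempty ι with hι | hι
  · simp [Subsingleton.elim e 0, Subsingleton.elim (fun i => p i * u i) 0]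
  · exact (pi_norm_le_iff_of_nonempty _).2 key

/-- If the Euler steps of a curve `f` of right derivative `g` at `x` decrease the norm at rate `c`,
then so does `f`, in the sense of upper right Dini derivatives. -/
theorem eventually_slope_norm_lt_of_eulerStep {E : Type*} [NormedAddCommGroup E] [NormedSpace ℝ E]
    {f : ℝ → E} {g : E} {x c r : ℝ} (hf : HasDerivWithinAt f g (Set.Ici x) x)
    (hstep : ∀ᶠ z in nhdsWithin x (Set.Ioi x), ‖f x + (z - x) • g‖ ≤ ‖f x‖ - (z - x) * c)
    (hr : -c < r) :
    ∀ᶠ z in nhdsWithin x (Set.Ioi x), (z - x)⁻¹ * (‖f z‖ - ‖f x‖) < r := by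
  have hε : 0 < (r + c) / 2 := by linarith
  have ho := ((hasDerivWithinAt_iff_isLittleO.1 hf).def hε).filter_mono
    (nhdsWithin_mono x Set.Ioi_subset_Ici_self)
  filter_upwards [hstep, ho, self_mem_nhdsWithin] with z h1 h2 hz
  have hzx : 0 < z - x := sub_pos.2 hz
  rw [Real.norm_of_nonneg hzx.le] at h2
  have h3 : ‖f z‖ ≤ ‖f x + (z - x) • g‖ + ‖f z - f x - (z - x) • g‖ := by
    calc ‖f z‖ = ‖(f x + (z - x) • g) + (f z - f x - (z - x) • g)‖ := by congr 1; abel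
      _ ≤ _ := norm_add_le _ _
  rw [inv_mul_lt_iff₀ hzx]
  nlinarith [mul_pos hzx hε]

/-- Any differentiable solution on `[0,∞)` of the ODE
`q_i'(t) = π_i((T q(t))_i − q_i(t))`, where `T` is a sup-norm `γ`-contraction with fixed point
`x*` and `π_i > 0`, satisfies `‖q(t) − x*‖_∞ ≤ e^{−(1−γ)π_min t}·‖q(0) − x*‖_∞` and converges
to `x*` as `t → ∞`. -/
theorem ode_converges_to_fixed_point
    (d : ℕ) (hd : 1 ≤ d)
    (γ : ℝ) (hγ : γ ∈ Set.Ioo (0 : ℝ) 1)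
    (T : (Fin d → ℝ) → (Fin d → ℝ))
    (hT : ∀ x y : Fin d → ℝ, ‖T x - T y‖ ≤ γ * ‖x - y‖)
    (xstar : Fin d → ℝ) (hfix : T xstar = xstar)
    (π : Fin d → ℝ) (hπ : ∀ i, 0 < π i)
    (πmin : ℝ) (hπmin : πmin = ⨅ i, π i)
    (q : ℝ → Fin d → ℝ)
    (hq : ∀ t : ℝ, 0 ≤ t → ∀ i,
      HasDerivWithinAt (fun t' => q t' i) (π i * (T (q t) i - q t i)) (Set.Ici 0) t) :
    (∀ t : ℝ, 0 ≤ t →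
      ‖q t - xstar‖ ≤ Real.exp (-(1 - γ) * πmin * t) * ‖q 0 - xstar‖) ∧
    Tendsto q atTop (nhds xstar) := by
  have : Nonempty (Fin d) := ⟨⟨0, hd⟩⟩
  have hm : ∀ i, πmin ≤ π i := fun i => hπmin ▸ ciInf_le (Set.finite_range π).bddBelow i
  have hm0 : 0 < πmin := by
    obtain ⟨i, hi⟩ := exists_eq_ciInf_of_finite (f := π)
    rw [hπmin, ← hi]
    exact hπ i
  have hderiv : ∀ t : ℝ, 0 ≤ t → HasDerivWithinAt (fun s => q s - xstar)
      (fun i => π i * ((T (q t) - xstar) i - (q t - xstar) i)) (Set.Ici 0) t := by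
    intro t ht
    refine HasDerivWithinAt.sub_const _ (hasDerivWithinAt_pi.2 fun i => ?_)
    simpa using hq t ht i
  have hbound : ∀ t : ℝ, 0 ≤ t →
      ‖q t - xstar‖ ≤ Real.exp (-(1 - γ) * πmin * t) * ‖q 0 - xstar‖ := by
    intro t ht
    have hgr := le_gronwallBound_of_liminf_deriv_right_le (f := fun s => ‖q s - xstar‖)
      (f' := fun s => -((1 - γ) * πmin * ‖q s - xstar‖)) (δ := ‖q 0 - xstar‖)
      (K := -(1 - γ) * πmin) (ε := 0) (a := 0) (b := t)
      (fun s hs => ((hderiv s hs.1).continuousWithinAt.mono Set.Icc_subset_Ici_self).norm)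
      (fun s hs r hr => by
        refine (eventually_slope_norm_lt_of_eulerStep
          ((hderiv s hs.1).mono (Set.Ici_subset_Ici.2 hs.1)) ?_ hr).frequently
        have hsmall : ∀ᶠ z in nhdsWithin s (Set.Ioi s), ∀ i, (z - s) * π i ≤ 1 := by
          refine eventually_all.2 fun i => nhdsWithin_le_nhds ?_
          have hc : Tendsto (fun z => (z - s) * π i) (nhds s) (nhds 0) := by
            have : Continuous fun z => (z - s) * π i := by fun_prop
            simpa using this.tendsto s
          exact hc.eventually_le_const one_pos
        filter_upwards [hsmall, self_mem_nhdsWithin] with z hz hsz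
        refine norm_eulerStep_le hγ.2.le hm hm0.le ?_ (sub_nonneg.2 (le_of_lt hsz)) hz
        simpa only [hfix] using hT (q s) xstar)
      le_rfl (fun s _ => by linarith) t ⟨ht, le_rfl⟩
    rwa [gronwallBound_ε0, sub_zero, mul_comm] at hgr
  refine ⟨hbound, tendsto_iff_norm_sub_tendsto_zero.2 ?_⟩
  have hc : -(1 - γ) * πmin < 0 := by nlinarith [hγ.2]
  have hexp : Tendsto (fun t => Real.exp (-(1 - γ) * πmin * t) * ‖q 0 - xstar‖) atTop (nhds 0) := by
    simpa using (Real.tendsto_exp_atBot.comp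
      (tendsto_id.const_mul_atTop_of_neg hc)).mul_const ‖q 0 - xstar‖
  exact squeeze_zero' (Eventually.of_forall fun _ => norm_nonneg _)
    ((eventually_ge_atTop 0).mono hbound) hexp
end
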